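/- (Consensus-error-to-gradient-error bound, B-part; deterministic core of Lemma 3.) Let f₁,…,fₙ : ℝ^{d₁×d₂} → ℝ each be differentiable with L-Lipschitz gradient and ‖∇f_i(W)‖_F ≤ G for all W and all i. Fix W₀ ∈ ℝ^{d₁×d₂}. Let A₁,…,Aₙ ∈ ℝ^{r×d₂} and B₁,…,Bₙ ∈ ℝ^{d₁×r} with ‖A_i‖_F ≤ C_A and ‖B_i‖_F ≤ C_B for all i, and let Ā = (1/n)∑_i A_i, B̄ = (1/n)∑_i B_i, which also satisfy ‖Ā‖_F ≤ C_A and ‖B̄‖_F ≤ C_B. Then ‖(1/n)∑_{i=1}^n (∇f_i(W₀+B_iA_i)·A_iᵀ − ∇f_i(W₀+B̄Ā)·Āᵀ)‖_F² ≤ (8(G² + L²C_B²C_A²)/n)·∑_{i=1}^n ‖A_i − Ā‖_F² + (4L²C_A⁴/n)·∑_{i=1}^n ‖B_i − B̄‖_F². -/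

import Mathlib

open Matrix Finset

attribute [local instance] Matrix.frobeniusSeminormedAddCommGroup
  Matrix.frobeniusNormedAddCommGroup Matrix.frobeniusNormedSpace

/-- The Frobenius (trace) inner product of two real matrices. -/
noncomputable def frobInner {m n : Type*} [Fintype m] [Fintype n]
    (M N : Matrix m n ℝ) : ℝ :=
  ∑ i, ∑ j, M i j * N i j

/-- The Frobenius inner product with a fixed matrix `M`, as a continuous linear map. -/
noncomputable def frobInnerCLM {m n : Type*} [Fintype m] [Fintype n]
    (M : Matrix m n ℝ) : Matrix m n ℝ →L[ℝ] ℝ :=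
  LinearMap.toContinuousLinearMap
    { toFun := fun N => frobInner M N
      map_add' := by
        intro N₁ N₂
        simp [frobInner, Matrix.add_apply, mul_add, Finset.sum_add_distrib]
      map_smul' := by
        intro c N
        simp only [frobInner, Matrix.smul_apply, smul_eq_mul, RingHom.id_apply]
        rw [Finset.mul_sum]
        refine Finset.sum_congr rfl fun i _ => ?_
        rw [Finset.mul_sum]
        exact Finset.sum_congr rfl fun j _ => by ring }

theorem norm_inv_smul_sum_sq_le {E : Type*} [SeminormedAddCommGroup E] [NormedSpace ℝ E]
    {n : ℕ} (hn : 1 ≤ n) (v : Fin n → E) :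
    ‖(n : ℝ)⁻¹ • ∑ i, v i‖ ^ 2 ≤ (n : ℝ)⁻¹ * ∑ i, ‖v i‖ ^ 2 := by
  have hn' : (0 : ℝ) < n := by exact_mod_cast hn
  have hsum : ‖∑ i, v i‖ ^ 2 ≤ n * ∑ i, ‖v i‖ ^ 2 := by
    calc ‖∑ i, v i‖ ^ 2 ≤ (∑ i, ‖v i‖) ^ 2 := by
          gcongr
          exact norm_sum_le _ _
      _ ≤ n * ∑ i, ‖v i‖ ^ 2 := by
          simpa using sq_sum_le_card_mul_sum_sq (s := Finset.univ) (f := fun i => ‖v i‖)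
  rw [norm_smul, mul_pow, Real.norm_of_nonneg (by positivity)]
  calc ((n : ℝ)⁻¹) ^ 2 * ‖∑ i, v i‖ ^ 2
      ≤ ((n : ℝ)⁻¹) ^ 2 * (n * ∑ i, ‖v i‖ ^ 2) := by gcongr
    _ = (n : ℝ)⁻¹ * ∑ i, ‖v i‖ ^ 2 := by field_simp

theorem frobenius_norm_mul_sub_mul_le {l m n : Type*} [Fintype l] [Fintype m] [Fintype n]
    (M M' : Matrix l m ℝ) (N N' : Matrix m n ℝ) :
    ‖M * N - M' * N'‖ ≤ ‖M‖ * ‖N - N'‖ + ‖M - M'‖ * ‖N'‖ := by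
  have h : M * N - M' * N' = M * (N - N') + (M - M') * N' := by
    rw [Matrix.mul_sub, Matrix.sub_mul]
    abel
  rw [h]
  exact (norm_add_le _ _).trans
    (add_le_add (Matrix.frobenius_norm_mul _ _) (Matrix.frobenius_norm_mul _ _))

theorem norm_lora_grad_sub_sq_le {l m n : Type*} [Fintype l] [Fintype m] [Fintype n]
    (g : Matrix l n ℝ → Matrix l n ℝ) {L G a b : ℝ}
    (hlip : ∀ W W', ‖g W - g W'‖ ≤ L * ‖W - W'‖) (hbdd : ∀ W, ‖g W‖ ≤ G)
    (W₀ : Matrix l n ℝ) (A A' : Matrix m n ℝ) (B B' : Matrix l m ℝ)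
    (hB : ‖B‖ ≤ b) (hA' : ‖A'‖ ≤ a) :
    ‖g (W₀ + B * A) * Aᵀ - g (W₀ + B' * A') * A'ᵀ‖ ^ 2
      ≤ 8 * (G ^ 2 + L ^ 2 * b ^ 2 * a ^ 2) * ‖A - A'‖ ^ 2
        + 4 * L ^ 2 * a ^ 4 * ‖B - B'‖ ^ 2 := by
  have ha : 0 ≤ a := (norm_nonneg _).trans hA'
  set x := ‖A - A'‖
  set y := ‖B - B'‖
  have hx : 0 ≤ x := norm_nonneg _
  have hy : 0 ≤ y := norm_nonneg _
  have hprod : ‖B * A - B' * A'‖ ≤ b * x + y * a :=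
    (frobenius_norm_mul_sub_mul_le B B' A A').trans (by gcongr)
  have hgrad : ‖g (W₀ + B * A) - g (W₀ + B' * A')‖ ≤ |L| * (b * x + y * a) := by
    refine (hlip _ _).trans ?_
    rw [add_sub_add_left_eq_sub]
    gcongr
    exact le_abs_self L
  have hnorm : ‖g (W₀ + B * A) * Aᵀ - g (W₀ + B' * A') * A'ᵀ‖
      ≤ G * x + |L| * (b * x + y * a) * a := by
    refine (frobenius_norm_mul_sub_mul_le _ _ _ _).trans ?_
    rw [← Matrix.transpose_sub, Matrix.frobenius_norm_transpose, Matrix.frobenius_norm_transpose]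
    have hbdd' := hbdd (W₀ + B * A)
    have hpos := (norm_nonneg _).trans hgrad
    gcongr
  have hL : |L| ^ 2 = L ^ 2 := sq_abs L
  calc ‖g (W₀ + B * A) * Aᵀ - g (W₀ + B' * A') * A'ᵀ‖ ^ 2
      ≤ (G * x + |L| * (b * x + y * a) * a) ^ 2 := by gcongr
    _ ≤ 8 * (G ^ 2 + |L| ^ 2 * b ^ 2 * a ^ 2) * x ^ 2 + 4 * |L| ^ 2 * a ^ 4 * y ^ 2 := by
        linarith [sq_nonneg (G * x + |L| * b * x * a - |L| * y * a ^ 2),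
          sq_nonneg (G * x - |L| * b * x * a), sq_nonneg (G * x),
          sq_nonneg (|L| * b * x * a), sq_nonneg (|L| * y * a ^ 2)]
    _ = _ := by rw [hL]

/-- consensus-error-to-gradient-error bound, B-part (deterministic core of
Lemma 3). -/
theorem statement_14 {d₁ d₂ r n : ℕ} (hn : 1 ≤ n)
    (f : Fin n → Matrix (Fin d₁) (Fin d₂) ℝ → ℝ)
    (gradf : Fin n → Matrix (Fin d₁) (Fin d₂) ℝ → Matrix (Fin d₁) (Fin d₂) ℝ)
    (L G C_A C_B : ℝ)
    (hdiff : ∀ i W, HasFDerivAt (f i) (frobInnerCLM (gradf i W)) W)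
    (hlip : ∀ i W W', ‖gradf i W - gradf i W'‖ ≤ L * ‖W - W'‖)
    (hbdd : ∀ i W, ‖gradf i W‖ ≤ G)
    (W₀ : Matrix (Fin d₁) (Fin d₂) ℝ)
    (A : Fin n → Matrix (Fin r) (Fin d₂) ℝ) (B : Fin n → Matrix (Fin d₁) (Fin r) ℝ)
    (hA : ∀ i, ‖A i‖ ≤ C_A) (hB : ∀ i, ‖B i‖ ≤ C_B)
    (Abar : Matrix (Fin r) (Fin d₂) ℝ) (Bbar : Matrix (Fin d₁) (Fin r) ℝ)
    (hAbar : Abar = (n : ℝ)⁻¹ • ∑ i, A i) (hBbar : Bbar = (n : ℝ)⁻¹ • ∑ i, B i)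
    (hAbarN : ‖Abar‖ ≤ C_A) (hBbarN : ‖Bbar‖ ≤ C_B) :
    ‖(n : ℝ)⁻¹ • ∑ i, (gradf i (W₀ + B i * A i) * (A i)ᵀ - gradf i (W₀ + Bbar * Abar) * Abarᵀ)‖ ^ 2
      ≤ 8 * (G ^ 2 + L ^ 2 * C_B ^ 2 * C_A ^ 2) / (n : ℝ) * ∑ i, ‖A i - Abar‖ ^ 2
        + 4 * L ^ 2 * C_A ^ 4 / (n : ℝ) * ∑ i, ‖B i - Bbar‖ ^ 2 := by
  refine (norm_inv_smul_sum_sq_le hn _).trans ?_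
  calc (n : ℝ)⁻¹ * ∑ i, ‖gradf i (W₀ + B i * A i) * (A i)ᵀ
          - gradf i (W₀ + Bbar * Abar) * Abarᵀ‖ ^ 2
      ≤ (n : ℝ)⁻¹ * ∑ i, (8 * (G ^ 2 + L ^ 2 * C_B ^ 2 * C_A ^ 2) * ‖A i - Abar‖ ^ 2
          + 4 * L ^ 2 * C_A ^ 4 * ‖B i - Bbar‖ ^ 2) := by
        gcongr with i
        exact norm_lora_grad_sub_sq_le (gradf i) (hlip i) (hbdd i) W₀ _ _ _ _ (hB i) hAbarN
    _ = _ := by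
        rw [Finset.sum_add_distrib, ← Finset.mul_sum, ← Finset.mul_sum]
        ring
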